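/- Let q be a real number with 0 < q < 1 (viewed as a complex number) and let α, β be complex numbers, where q^α := exp(α log q). Then for every natural number n: (q^{α+β}; q)_n = ∑_{k=0}^{n} [n choose k]_q · q^{kβ} · (q^α; q)_k · (q^β; q)_{n−k}. -/

import Mathlib

noncomputable section

open scoped BigOperators

/-- The finite q-shifted factorial `(z; q)_n = ∏_{i=0}^{n-1} (1 - z q^i)` for complex `z`. -/
def qPochC (q : ℝ) (z : ℂ) (n : ℕ) : ℂ := ∏ i ∈ Finset.range n, (1 - z * (q : ℂ) ^ i)

/-- The q-binomial coefficient `[n choose k]_q = (q;q)_n / ((q;q)_k (q;q)_{n-k})`. -/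
def qBinomC (q : ℝ) (n k : ℕ) : ℂ :=
  qPochC q (q : ℂ) n / (qPochC q (q : ℂ) k * qPochC q (q : ℂ) (n - k))

theorem qPochC_zero (q : ℝ) (z : ℂ) : qPochC q z 0 = 1 := by
  simp [qPochC]

theorem qPochC_succ (q : ℝ) (z : ℂ) (n : ℕ) :
    qPochC q z (n + 1) = qPochC q z n * (1 - z * (q : ℂ) ^ n) := by
  simp [qPochC, Finset.prod_range_succ]

theorem one_sub_ofReal_pow_succ_ne_zero {q : ℝ} (hq0 : 0 < q) (hq1 : q < 1) (n : ℕ) :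
    1 - (q : ℂ) ^ (n + 1) ≠ 0 := by
  have h : q ^ (n + 1) < 1 := pow_lt_one₀ hq0.le hq1 n.succ_ne_zero
  exact_mod_cast (sub_pos.mpr h).ne'

theorem qPochC_self_ne_zero {q : ℝ} (hq0 : 0 < q) (hq1 : q < 1) (n : ℕ) :
    qPochC q (q : ℂ) n ≠ 0 := by
  refine Finset.prod_ne_zero_iff.mpr fun i _ => ?_
  rw [← pow_succ']
  exact one_sub_ofReal_pow_succ_ne_zero hq0 hq1 i

theorem one_sub_pow_mul_qPochC_div_succ {q : ℝ} (hq0 : 0 < q) (hq1 : q < 1) (z : ℂ) (n : ℕ) :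
    (1 - (q : ℂ) ^ (n + 1)) * (qPochC q z (n + 1) / qPochC q (q : ℂ) (n + 1)) =
      (1 - z * (q : ℂ) ^ n) * (qPochC q z n / qPochC q (q : ℂ) n) := by
  have h₁ := one_sub_ofReal_pow_succ_ne_zero hq0 hq1 n
  have h₂ := qPochC_self_ne_zero hq0 hq1 n
  rw [qPochC_succ, qPochC_succ, ← pow_succ']
  field_simp

/-- The `q`-Vandermonde convolution, with each shifted factorial divided by `(q; q)`. -/
theorem sum_antidiagonal_qPochC_div {q : ℝ} (hq0 : 0 < q) (hq1 : q < 1) (a b : ℂ) (n : ℕ) :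
    ∑ p ∈ Finset.HasAntidiagonal.antidiagonal n,
        b ^ p.1 * (qPochC q a p.1 / qPochC q (q : ℂ) p.1) *
          (qPochC q b p.2 / qPochC q (q : ℂ) p.2) =
      qPochC q (a * b) n / qPochC q (q : ℂ) n := by
  induction n with
  | zero => simp [qPochC_zero]
  | succ n ih =>
    refine mul_left_cancel₀ (one_sub_ofReal_pow_succ_ne_zero hq0 hq1 n) ?_
    rw [one_sub_pow_mul_qPochC_div_succ hq0 hq1, ← ih, Finset.mul_sum, Finset.mul_sum]
    set A : ℕ → ℂ := fun i => qPochC q a i / qPochC q (q : ℂ) i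
    set B : ℕ → ℂ := fun j => qPochC q b j / qPochC q (q : ℂ) j
    have hA : ∀ i, (1 - (q : ℂ) ^ (i + 1)) * A (i + 1) = (1 - a * (q : ℂ) ^ i) * A i :=
      one_sub_pow_mul_qPochC_div_succ hq0 hq1 a
    have hB : ∀ j, (1 - (q : ℂ) ^ (j + 1)) * B (j + 1) = (1 - b * (q : ℂ) ^ j) * B j :=
      one_sub_pow_mul_qPochC_div_succ hq0 hq1 b
    calc
      ∑ p ∈ Finset.HasAntidiagonal.antidiagonal (n + 1),
            (1 - (q : ℂ) ^ (n + 1)) * (b ^ p.1 * A p.1 * B p.2)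
        = ∑ p ∈ Finset.HasAntidiagonal.antidiagonal (n + 1),
            b ^ p.1 * A p.1 * ((1 - (q : ℂ) ^ p.2) * B p.2) +
          ∑ p ∈ Finset.HasAntidiagonal.antidiagonal (n + 1),
            (q : ℂ) ^ p.2 * b ^ p.1 * ((1 - (q : ℂ) ^ p.1) * A p.1) * B p.2 := by
          rw [← Finset.sum_add_distrib]
          refine Finset.sum_congr rfl fun p hp => ?_
          rw [← Finset.HasAntidiagonal.mem_antidiagonal.mp hp]
          ring
      _ = ∑ p ∈ Finset.HasAntidiagonal.antidiagonal n,
            b ^ p.1 * A p.1 * ((1 - b * (q : ℂ) ^ p.2) * B p.2) +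
          ∑ p ∈ Finset.HasAntidiagonal.antidiagonal n,
            (q : ℂ) ^ p.2 * b ^ (p.1 + 1) * ((1 - a * (q : ℂ) ^ p.1) * A p.1) * B p.2 := by
          rw [Finset.Nat.sum_antidiagonal_succ', Finset.Nat.sum_antidiagonal_succ]
          simp only [hA, hB, pow_zero, sub_self, zero_mul, mul_zero, zero_add]
      _ = ∑ p ∈ Finset.HasAntidiagonal.antidiagonal n,
            (1 - a * b * (q : ℂ) ^ n) * (b ^ p.1 * A p.1 * B p.2) := by
          rw [← Finset.sum_add_distrib]
          refine Finset.sum_congr rfl fun p hp => ?_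
          rw [← Finset.HasAntidiagonal.mem_antidiagonal.mp hp]
          ring

/-- For `0 < q < 1` and complex `α, β`, and every natural `n`:
`(q^{α+β}; q)_n = ∑_{k=0}^{n} [n choose k]_q q^{kβ} (q^α; q)_k (q^β; q)_{n-k}`. -/
theorem qPoch_add_expansion (q : ℝ) (hq0 : 0 < q) (hq1 : q < 1) (α β : ℂ) (n : ℕ) :
    qPochC q ((q : ℂ) ^ (α + β)) n =
      ∑ k ∈ Finset.range (n + 1),
        qBinomC q n k * (q : ℂ) ^ ((k : ℂ) * β) *
          qPochC q ((q : ℂ) ^ α) k * qPochC q ((q : ℂ) ^ β) (n - k) := by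
  have hq : (q : ℂ) ≠ 0 := by exact_mod_cast hq0.ne'
  have hn := qPochC_self_ne_zero hq0 hq1 n
  rw [Complex.cpow_add _ _ hq, ← div_mul_cancel₀ (qPochC q _ n) hn,
    ← sum_antidiagonal_qPochC_div hq0 hq1, Finset.Nat.sum_antidiagonal_eq_sum_range_succ_mk,
    Finset.sum_mul]
  refine Finset.sum_congr rfl fun k _ => ?_
  rw [Complex.cpow_nat_mul, qBinomC]
  ring
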